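/- arXiv:2506.20925 — 4 statements merged into one kernel-verified Lean document; each statement's English description precedes it below -/
import Mathlib

section
/- Let c ≥ 0, α ∈ (0,1), and real numbers κ¹, κ², κ³, κ⁴, κ⁵ with c ≤ κ¹ ≤ κ² ≤ κ³ ≤ κ⁴ ≤ κ⁵ satisfying κ¹ − c = (1−α)·(κ³ − c) = α·(κ⁵ − κ⁴). Then for all real numbers v_l ≥ 0 and v_h ≥ 0, φ⋆(v_l) + ψ⋆(v_h) ≥ π(v_l, v_h). -/
open MeasureTheory Set Filter

noncomputable section

/-- The cumulative distribution function of a Borel measure on `ℝ`. -/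
def mCdf (μ : Measure ℝ) (v : ℝ) : ℝ := (μ (Iic v)).toReal

/-- Total variation distance between two measures on `ℝ`:
the supremum over Borel sets `A` of `|μ A - ν A|`. -/
def tvDist (μ ν : Measure ℝ) : ℝ :=
  sSup {x : ℝ | ∃ A : Set ℝ, MeasurableSet A ∧ x = |(μ A).toReal - (ν A).toReal|}

/-- Generalized inverse of a CDF: `F⁻¹ q = inf {v | q ≤ F v}`. -/
def invCdf (F : ℝ → ℝ) (q : ℝ) : ℝ := sInf {v : ℝ | q ≤ F v}

/-- `ρ` is a coupling of `(μ, ν)` iff its marginals are `μ` and `ν`. -/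
def IsCoupling (μ ν : Measure ℝ) (ρ : Measure (ℝ × ℝ)) : Prop :=
  ρ.fst = μ ∧ ρ.snd = ν

/-- The market primitives: probability measures `μl, μh` on `ℝ` with densities
`fl, fh` positive exactly on a common interval `(vlo, vhi)` (with `vhi` possibly `∞`),
and a strictly increasing likelihood ratio `fh / fl` on that interval. -/
structure MarketData where
  μl : Measure ℝ
  μh : Measure ℝ
  fl : ℝ → ℝ
  fh : ℝ → ℝ
  vlo : ℝ
  vhi : EReal
  probl : IsProbabilityMeasure μl
  probh : IsProbabilityMeasure μh
  meas_fl : Measurable fl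
  meas_fh : Measurable fh
  dens_l : μl = volume.withDensity (fun v => ENNReal.ofReal (fl v))
  dens_h : μh = volume.withDensity (fun v => ENNReal.ofReal (fh v))
  vlo_nonneg : 0 ≤ vlo
  vlo_lt_vhi : (vlo : EReal) < vhi
  fl_nonneg : ∀ v, 0 ≤ fl v
  fh_nonneg : ∀ v, 0 ≤ fh v
  fl_pos_iff : ∀ v : ℝ, 0 < fl v ↔ (vlo < v ∧ (v : EReal) < vhi)
  fh_pos_iff : ∀ v : ℝ, 0 < fh v ↔ (vlo < v ∧ (v : EReal) < vhi)
  lr_strictMono : StrictMonoOn (fun v => fh v / fl v) {v : ℝ | vlo < v ∧ (v : EReal) < vhi}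

/-- CDF of the `l`-group. -/
def MarketData.Fl (D : MarketData) : ℝ → ℝ := mCdf D.μl

/-- CDF of the `h`-group. -/
def MarketData.Fh (D : MarketData) : ℝ → ℝ := mCdf D.μh

/-- `Δ v = F_l v − F_h v`. -/
def MarketData.Δ (D : MarketData) (v : ℝ) : ℝ := D.Fl v - D.Fh v

/-- `vstar` is the unique maximizer of `Δ`, characterized by `f_l vstar = f_h vstar`. -/
def IsVStar (D : MarketData) (vstar : ℝ) : Prop :=
  D.fl vstar = D.fh vstar ∧ (∀ v, D.Δ v ≤ D.Δ vstar) ∧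
  (∀ v, (∀ w, D.Δ w ≤ D.Δ v) → v = vstar)

/-- A vector `κ = (κ¹, κ², κ³, κ⁴, κ⁵) ∈ ℝ⁵`. -/
structure Kappa where
  k1 : ℝ
  k2 : ℝ
  k3 : ℝ
  k4 : ℝ
  k5 : ℝ

/-- The κ-system at `(c, α)` for the pair of CDFs `(Fl, Fh)`:
`κ¹ ≤ κ² ≤ κ³ ≤ κ⁴ ≤ κ⁵`,
`κ² = Fl⁻¹(Δ κ³ + Fh κ¹) = Fl⁻¹(Δ κ⁴) = Fl⁻¹(Δ κ⁵)` and
`κ¹ − c = (1 − α)(κ³ − c) = α (κ⁵ − κ⁴)`. -/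
def KappaSystem (Fl Fh : ℝ → ℝ) (c α : ℝ) (κ : Kappa) : Prop :=
  κ.k1 ≤ κ.k2 ∧ κ.k2 ≤ κ.k3 ∧ κ.k3 ≤ κ.k4 ∧ κ.k4 ≤ κ.k5 ∧
  κ.k2 = invCdf Fl ((Fl κ.k3 - Fh κ.k3) + Fh κ.k1) ∧
  κ.k2 = invCdf Fl (Fl κ.k4 - Fh κ.k4) ∧
  κ.k2 = invCdf Fl (Fl κ.k5 - Fh κ.k5) ∧
  κ.k1 - c = (1 - α) * (κ.k3 - c) ∧
  κ.k1 - c = α * (κ.k5 - κ.k4)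

/-- The pairwise profit from a matched pair `(v_l, v_h)`:
`max { min{v_l,v_h} − c, α(v_h − c)⁺, (1−α)(v_l − c)⁺ }`. -/
def pairProfit (c α vl vh : ℝ) : ℝ :=
  max (min vl vh - c) (max (α * max (vh - c) 0) ((1 - α) * max (vl - c) 0))

/-- The set of matched-pair profit values achievable by couplings of `(μl, μh)`. -/
def couplingValues (μl μh : Measure ℝ) (c α : ℝ) : Set ℝ :=
  {x : ℝ | ∃ ρ : Measure (ℝ × ℝ), IsCoupling μl μh ρ ∧
    x = ∫ p, pairProfit c α p.1 p.2 ∂ρ}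

/-- The dual variable `φ⋆`. -/
def phiStar (c α k1 k3 k4 k5 : ℝ) (vl : ℝ) : ℝ :=
  if vl ≤ k3 then k1 - c
  else if vl ≤ k4 then (1 - α) * (vl - c)
  else if vl ≤ k5 then vl - c - α * (k4 - c)
  else (1 - α) * (vl - c) + (k1 - c)

/-- The dual variable `ψ⋆`. -/
def psiStar (c α k1 k3 k4 k5 : ℝ) (vh : ℝ) : ℝ :=
  if vh ≤ k1 then 0
  else if vh ≤ k3 then vh - k1
  else if vh ≤ k4 then α * (vh - c)
  else if vh ≤ k5 then α * (k4 - c)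
  else α * (vh - c) - (k1 - c)

/-- the dual pair `(φ⋆, ψ⋆)` is feasible:
`φ⋆(v_l) + ψ⋆(v_h) ≥ π(v_l, v_h)` for all `v_l, v_h ≥ 0`. -/
theorem stmt1 (c α : ℝ) (hc : 0 ≤ c) (hα : α ∈ Ioo (0 : ℝ) 1)
    (k1 k2 k3 k4 k5 : ℝ)
    (hck1 : c ≤ k1) (h12 : k1 ≤ k2) (h23 : k2 ≤ k3) (h34 : k3 ≤ k4) (h45 : k4 ≤ k5)
    (e1 : k1 - c = (1 - α) * (k3 - c)) (e2 : k1 - c = α * (k5 - k4)) :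
    ∀ vl vh : ℝ, 0 ≤ vl → 0 ≤ vh →
      pairProfit c α vl vh ≤ phiStar c α k1 k3 k4 k5 vl + psiStar c α k1 k3 k4 k5 vh := by
  obtain ⟨hα0, hα1⟩ := hα
  have hβ : 0 < 1 - α := by linarith
  have mul_mono : ∀ x y : ℝ, x ≤ y → α * x ≤ α * y := fun x y h =>
    mul_le_mul_of_nonneg_left h hα0.le
  have mul_mono' : ∀ x y : ℝ, x ≤ y → (1 - α) * x ≤ (1 - α) * y := fun x y h =>
    mul_le_mul_of_nonneg_left h hβ.le
  have h34α := mul_mono k3 k4 h34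
  intro vl vh _ _
  have hφ0 : k1 - c ≤ phiStar c α k1 k3 k4 k5 vl := by
    unfold phiStar
    split_ifs with h3 h4 h5
    · exact le_rfl
    · linarith [mul_mono' k3 vl (by linarith)]
    · linarith [mul_mono' k3 k4 h34]
    · linarith [mul_mono' k3 vl (by linarith)]
  have hφ1 : (1 - α) * (vl - c) ≤ phiStar c α k1 k3 k4 k5 vl := by
    unfold phiStar
    split_ifs with h3 h4 h5
    · linarith [mul_mono' vl k3 h3]
    · exact le_rfl
    · linarith [mul_mono k4 vl (by linarith)]
    · linarith
  have hψ0 : 0 ≤ psiStar c α k1 k3 k4 k5 vh := by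
    unfold psiStar
    split_ifs with h1 h3 h4 h5
    · exact le_rfl
    · linarith
    · linarith [mul_mono k3 vh (by linarith)]
    · linarith
    · linarith [mul_mono k5 vh (by linarith)]
  have hψ1 : α * (vh - c) ≤ psiStar c α k1 k3 k4 k5 vh + (k1 - c) := by
    unfold psiStar
    split_ifs with h1 h3 h4 h5
    · linarith [mul_mono vh k1 h1, mul_mono' c k1 hck1]
    · linarith [mul_mono' c vh (by linarith)]
    · linarith
    · linarith [mul_mono vh k5 h5]
    · linarith
  have hmin : min vl vh - c ≤ phiStar c α k1 k3 k4 k5 vl + psiStar c α k1 k3 k4 k5 vh := by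
    have hl := min_le_left vl vh
    have hr := min_le_right vl vh
    have hlα := mul_mono' _ _ hl
    have hrα := mul_mono _ _ hr
    unfold psiStar at *
    split_ifs at * with h1 h3 h4 h5
    · linarith
    · linarith
    · linarith
    · unfold phiStar at *
      split_ifs at * with g3 g4 g5
      · linarith
      · linarith [mul_mono vl k4 g4]
      · linarith
      · linarith [mul_mono vh k5 h5]
    · unfold phiStar at *
      split_ifs at * with g3 g4 g5
      · linarith [mul_mono k5 vh (by linarith)]
      · linarith [mul_mono k5 vh (by linarith), mul_mono vl k4 g4]
      · linarith [mul_mono k5 vh (by linarith)]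
      · linarith
  unfold pairProfit
  refine max_le hmin (max_le ?_ ?_)
  · rw [mul_max_of_nonneg _ _ hα0.le, mul_zero]
    exact max_le (by linarith) (by linarith)
  · rw [mul_max_of_nonneg _ _ hβ.le, mul_zero]
    exact max_le (by linarith) (by linarith)
end
end

section
/- Suppose F_l(c) < ‖F_l − F_h‖, let κ be the unique solution of the κ-system at (c, α) with κ⁴ < v⋆ < κ⁵, and let ρ⋆ be the Borel probability measure on ℝ² defined by ρ⋆(A × B) = ∫_B γ⋆(v_h)(A) dμ_h(v_h). Then ρ⋆ is a coupling of (F_l, F_h): its first marginal equals μ_l and its second marginal equals μ_h. -/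
open MeasureTheory Set Filter

noncomputable section

/-- The smaller solution of `Δ v = q` (the generalized inverse of `Δ` on its
increasing part): `Δ̲⁻¹ q = inf {v | q ≤ Δ v}`. -/
def lowerDeltaInv (Δfn : ℝ → ℝ) (q : ℝ) : ℝ := sInf {v : ℝ | q ≤ Δfn v}

/-- The larger solution of `Δ v = q`: `Δ̄⁻¹ q = sup {v | q ≤ Δ v}`. -/
def upperDeltaInv (Δfn : ℝ → ℝ) (q : ℝ) : ℝ := sSup {v : ℝ | q ≤ Δfn v}

/-- The Markov kernel `γ⋆` describing the optimal matching of `l`-values to each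
`h`-value `v_h`. -/
def gammaStar (D : MarketData) (κ : Kappa) (vh : ℝ) : Measure ℝ :=
  if vh ≤ κ.k1 then
    Measure.dirac (lowerDeltaInv D.Δ (D.Fh vh + D.Δ κ.k3))
  else if vh ≤ κ.k3 then
    Measure.dirac (invCdf D.Fl (D.Fh vh + D.Δ κ.k3))
  else if vh ≤ κ.k4 then
    Measure.dirac vh
  else if vh ≤ κ.k5 then
    Measure.dirac (invCdf D.Fl (D.Fh vh + D.Δ κ.k4))
  else
    ENNReal.ofReal (D.fl vh / D.fh vh) • Measure.dirac vh +
      ENNReal.ofReal (1 - D.fl vh / D.fh vh) •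
        Measure.dirac (invCdf D.Fl (D.Δ κ.k5 - D.Δ vh))

section Cdf

variable (m : Measure ℝ)

lemma mCdf_nonneg (v : ℝ) : 0 ≤ mCdf m v := ENNReal.toReal_nonneg

lemma invCdf_mCdf_of_nonpos {q : ℝ} (hq : q ≤ 0) : invCdf (mCdf m) q = 0 := by
  have : {v | q ≤ mCdf m v} = univ := eq_univ_of_forall fun v => hq.trans (mCdf_nonneg m v)
  rw [invCdf, this, Real.sInf_univ]

variable [IsFiniteMeasure m]

lemma monotone_mCdf : Monotone (mCdf m) := fun _ _ h =>
  measureReal_mono (Iic_subset_Iic.2 h)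

lemma ofReal_mCdf (v : ℝ) : ENNReal.ofReal (mCdf m v) = m (Iic v) :=
  ENNReal.ofReal_toReal (measure_ne_top _ _)

lemma exists_mCdf_lt {ε : ℝ} (hε : 0 < ε) : ∃ v, mCdf m v < ε := by
  have h := tendsto_measure_iInter_atBot (μ := m) (s := fun v : ℝ => Iic v)
    (fun v => measurableSet_Iic.nullMeasurableSet) monotone_Iic ⟨0, measure_ne_top _ _⟩
  rw [iInter_Iic_eq_empty_iff.2 (by simp), measure_empty] at h
  have h' := (ENNReal.tendsto_toReal ENNReal.zero_ne_top).comp h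
  exact (h'.eventually (gt_mem_nhds (by simpa using hε))).exists

lemma exists_lt_mCdf {t : ℝ} (ht : t < m.real univ) : ∃ v, t < mCdf m v := by
  have h := (ENNReal.tendsto_toReal (measure_ne_top m univ)).comp (tendsto_measure_Iic_atTop m)
  exact (h.eventually (lt_mem_nhds ht)).exists

lemma measure_Ioc_eq_ofReal_mCdf_sub (a b : ℝ) :
    m (Ioc a b) = ENNReal.ofReal (mCdf m b - mCdf m a) := by
  rcases le_total a b with hab | hab
  · rw [ENNReal.ofReal_sub _ (mCdf_nonneg m a), ofReal_mCdf, ofReal_mCdf, ← Iic_sdiff_Iic,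
      measure_sdiff (Iic_subset_Iic.2 hab) measurableSet_Iic.nullMeasurableSet (measure_ne_top _ _)]
  · rw [Ioc_eq_empty (not_lt.2 hab), measure_empty,
      ENNReal.ofReal_of_nonpos (sub_nonpos.2 (monotone_mCdf m hab))]

variable [NullSingletonClass m]

lemma continuous_mCdf : Continuous (mCdf m) := by
  have h : mCdf m = fun b => mCdf m 0 + ∫ _ in (0 : ℝ)..b, (1 : ℝ) ∂m := by
    funext b
    rw [← intervalIntegral.integral_Iic_sub_Iic (integrable_const _) (integrable_const _)]
    simp [mCdf, Measure.real]
  rw [h]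
  exact continuous_const.add (intervalIntegral.continuous_primitive
    (fun a b => intervalIntegrable_const) 0)

/-- The probability integral transform: the `m`-mass of a sublevel set of the CDF of `m`. -/
lemma measure_mCdf_le (t : ℝ) :
    m {v | mCdf m v ≤ t} = min (ENNReal.ofReal t) (m univ) := by
  rcases le_or_gt (m.real univ) t with hM | hM
  · have : {v | mCdf m v ≤ t} = univ :=
      eq_univ_of_forall fun v => (measureReal_mono (subset_univ _)).trans hM
    rw [this, min_eq_right]
    exact (ENNReal.le_ofReal_iff_toReal_le (measure_ne_top _ _)
      (measureReal_nonneg.trans hM)).2 hM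
  rw [min_eq_left (ENNReal.ofReal_le_of_le_toReal hM.le)]
  rcases eq_empty_or_nonempty {v | mCdf m v ≤ t} with he | hne
  · rw [he, measure_empty, eq_comm, ENNReal.ofReal_eq_zero]
    by_contra! ht
    obtain ⟨v, hv⟩ := exists_mCdf_lt m ht
    exact (he ▸ (hv.le : v ∈ {v | mCdf m v ≤ t}) : v ∈ (∅ : Set ℝ))
  · obtain ⟨b, hb⟩ := exists_lt_mCdf m hM
    have hbdd : BddAbove {v | mCdf m v ≤ t} :=
      ⟨b, fun v hv => le_of_not_gt fun h => absurd (monotone_mCdf m h.le) (not_le.2 (hv.trans_lt hb))⟩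
    set s := sSup {v | mCdf m v ≤ t} with hs
    have hmem : mCdf m s ≤ t :=
      (isClosed_le (continuous_mCdf m) continuous_const).csSup_mem hne hbdd
    have hset : {v | mCdf m v ≤ t} = Iic s :=
      Subset.antisymm (fun v hv => le_csSup hbdd hv) fun v hv => (monotone_mCdf m hv).trans hmem
    have heq : mCdf m s = t := by
      refine hmem.antisymm (le_of_not_gt fun hlt => ?_)
      obtain ⟨w, hw, hsw⟩ := (((continuous_mCdf m).continuousAt.eventually
        (gt_mem_nhds hlt)).filter_mono nhdsWithin_le_nhds |>.and
          (self_mem_nhdsWithin : Ioi s ∈ nhdsWithin s (Ioi s))).exists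
      exact absurd (le_csSup hbdd (show w ∈ {v | mCdf m v ≤ t} from hw.le)) (not_le.2 hsw)
    rw [hset, ← ofReal_mCdf, heq]

lemma ae_mCdf_pos : ∀ᵐ v ∂m, 0 < mCdf m v := by
  simpa [ae_iff] using measure_mCdf_le m 0

/-- Transporting `m` by a map whose sublevel sets are those of the CDF of `m`. -/
lemma lintegral_dirac_Iic {T : ℝ → ℝ} {a t : ℝ}
    (hT : ∀ᵐ v ∂m, 0 < mCdf m v → (T v ≤ a ↔ mCdf m v ≤ t)) :
    ∫⁻ v, Measure.dirac (T v) (Iic a) ∂m = min (ENNReal.ofReal t) (m univ) := by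
  rw [← measure_mCdf_le, ← lintegral_indicator_one
    (measurableSet_le (continuous_mCdf m).measurable measurable_const)]
  refine lintegral_congr_ae ?_
  filter_upwards [hT, ae_mCdf_pos m] with v hv hpos
  rw [Measure.dirac_apply' _ measurableSet_Iic]
  simp only [indicator, mem_Iic, mem_ofPred_eq, hv hpos, Pi.one_apply]

lemma invCdf_mCdf_le_iff {q a b : ℝ} (hq : 0 < q) (hb : q ≤ mCdf m b) :
    invCdf (mCdf m) q ≤ a ↔ q ≤ mCdf m a := by
  obtain ⟨w, hw⟩ := exists_mCdf_lt m hq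
  have hbdd : BddBelow {v | q ≤ mCdf m v} :=
    ⟨w, fun v hv => le_of_not_gt fun h =>
      absurd (monotone_mCdf m h.le) (not_le.2 (hw.trans_le hv))⟩
  have hmem : q ≤ mCdf m (invCdf (mCdf m) q) :=
    (isClosed_le continuous_const (continuous_mCdf m)).csInf_mem ⟨b, hb⟩ hbdd
  exact ⟨fun h => hmem.trans (monotone_mCdf m h), fun h => csInf_le hbdd h⟩

lemma mCdf_invCdf {q b : ℝ} (hq : 0 < q) (hb : q ≤ mCdf m b) :
    mCdf m (invCdf (mCdf m) q) = q := by
  refine le_antisymm (le_of_not_gt fun hlt => ?_) ((invCdf_mCdf_le_iff m hq hb).1 le_rfl)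
  obtain ⟨w, hw, hsw⟩ := (((continuous_mCdf m).continuousAt.eventually
    (lt_mem_nhds hlt)).filter_mono nhdsWithin_le_nhds |>.and
      (self_mem_nhdsWithin : Iio (invCdf (mCdf m) q) ∈ nhdsWithin _ (Iio _))).exists
  exact absurd ((invCdf_mCdf_le_iff m hq hb).2 hw.le) (not_le.2 hsw)

end Cdf

section Restrict

variable (μ : Measure ℝ)

lemma mCdf_restrict_Iic {b v : ℝ} (hv : v ≤ b) : mCdf (μ.restrict (Iic b)) v = mCdf μ v := by
  rw [mCdf, Measure.restrict_apply measurableSet_Iic, Iic_inter_Iic, min_eq_left hv, mCdf]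

lemma mCdf_restrict_Ioc [IsFiniteMeasure μ] {a b v : ℝ} (hv : v ∈ Ioc a b) :
    mCdf (μ.restrict (Ioc a b)) v = mCdf μ v - mCdf μ a := by
  rw [mCdf, Measure.restrict_apply measurableSet_Iic, inter_comm, Ioc_inter_Iic,
    min_eq_right hv.2, measure_Ioc_eq_ofReal_mCdf_sub,
    ENNReal.toReal_ofReal (sub_nonneg.2 (monotone_mCdf μ hv.1.le))]

lemma setLIntegral_dirac_self_Iic (s : Set ℝ) (x : ℝ) :
    ∫⁻ v in s, Measure.dirac v (Iic x) ∂μ = μ (Iic x ∩ s) := by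
  rw [← Measure.restrict_apply measurableSet_Iic, ← lintegral_indicator_one measurableSet_Iic]
  exact lintegral_congr fun v => Measure.dirac_apply' _ measurableSet_Iic

end Restrict

namespace MarketData

variable (D : MarketData)

instance : IsProbabilityMeasure D.μl := D.probl

instance : IsProbabilityMeasure D.μh := D.probh

instance : NullSingletonClass D.μl := by
  rw [D.dens_l]; infer_instance

instance : NullSingletonClass D.μh := by
  rw [D.dens_h]; infer_instance

lemma monotone_Fl : Monotone D.Fl := monotone_mCdf D.μl

lemma monotone_Fh : Monotone D.Fh := monotone_mCdf D.μh

lemma continuous_Δ : Continuous D.Δ :=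
  (continuous_mCdf D.μl).sub (continuous_mCdf D.μh)

lemma Δ_add_Fh (v : ℝ) : D.Δ v + D.Fh v = D.Fl v := sub_add_cancel _ _

lemma Δ_le_Fl (v : ℝ) : D.Δ v ≤ D.Fl v := sub_le_self _ (mCdf_nonneg D.μh v)

lemma μl_apply {s : Set ℝ} (hs : MeasurableSet s) :
    D.μl s = ∫⁻ v in s, ENNReal.ofReal (D.fl v) := by
  rw [D.dens_l, withDensity_apply _ hs]

lemma μh_apply {s : Set ℝ} (hs : MeasurableSet s) :
    D.μh s = ∫⁻ v in s, ENNReal.ofReal (D.fh v) := by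
  rw [D.dens_h, withDensity_apply _ hs]

lemma μl_Ioc (a b : ℝ) : D.μl (Ioc a b) = ENNReal.ofReal (D.Fl b - D.Fl a) :=
  measure_Ioc_eq_ofReal_mCdf_sub D.μl a b

lemma μh_Ioc (a b : ℝ) : D.μh (Ioc a b) = ENNReal.ofReal (D.Fh b - D.Fh a) :=
  measure_Ioc_eq_ofReal_mCdf_sub D.μh a b

lemma measurable_ofReal_ratio : Measurable fun v => ENNReal.ofReal (D.fl v / D.fh v) :=
  (D.meas_fl.div D.meas_fh).ennreal_ofReal

lemma exists_fl_pos {s : Set ℝ} (hs : MeasurableSet s) (h : D.μl s ≠ 0) :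
    ∃ v ∈ s, 0 < D.fl v := by
  contrapose! h
  rw [D.μl_apply hs, setLIntegral_congr_fun hs fun v hv => ENNReal.ofReal_of_nonpos (h v hv),
    lintegral_zero]

lemma exists_fh_pos {s : Set ℝ} (hs : MeasurableSet s) (h : D.μh s ≠ 0) :
    ∃ v ∈ s, 0 < D.fh v := by
  contrapose! h
  rw [D.μh_apply hs, setLIntegral_congr_fun hs fun v hv => ENNReal.ofReal_of_nonpos (h v hv),
    lintegral_zero]

lemma fl_eq_zero_of_fh_eq_zero {v : ℝ} (h : D.fh v = 0) : D.fl v = 0 := by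
  refine ((D.fl_nonneg v).eq_or_lt').resolve_right fun hpos => ?_
  exact absurd ((D.fh_pos_iff v).2 ((D.fl_pos_iff v).1 hpos)) h.not_gt

lemma fh_eq_zero_of_fl_eq_zero {v : ℝ} (h : D.fl v = 0) : D.fh v = 0 := by
  refine ((D.fh_nonneg v).eq_or_lt').resolve_right fun hpos => ?_
  exact absurd ((D.fl_pos_iff v).2 ((D.fh_pos_iff v).1 hpos)) h.not_gt

/-- A point with `Δ > 0` on each side of `w` forces `w` into the common support. -/
lemma fl_pos_of_Δ_pos {a b w : ℝ} (ha : 0 < D.Δ a) (hb : 0 < D.Δ b) (haw : a < w) (hwb : w < b) :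
    0 < D.fl w := by
  have hla : D.μl (Iic a) ≠ 0 := fun h => by
    have : D.Fl a = 0 := by simp [Fl, mCdf, h]
    linarith [D.Δ_le_Fl a]
  have hhb : D.μh (Ioi b) ≠ 0 := fun h => by
    have h1 : D.Fh b = 1 := by
      rw [← compl_Iic, prob_compl_eq_zero_iff measurableSet_Iic] at h
      simp [Fh, mCdf, h]
    have h2 : D.Fl b ≤ 1 := measureReal_le_one
    simp only [Δ] at hb
    linarith
  obtain ⟨u, hu, hu'⟩ := D.exists_fl_pos measurableSet_Iic hla
  obtain ⟨v, hv, hv'⟩ := D.exists_fh_pos measurableSet_Ioi hhb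
  refine (D.fl_pos_iff w).2 ⟨((D.fl_pos_iff u).1 hu').1.trans (lt_of_le_of_lt hu haw), ?_⟩
  exact lt_trans (EReal.coe_lt_coe_iff.2 (hwb.trans hv)) ((D.fh_pos_iff v).1 hv').2

lemma fh_le_fl_of_le {w : ℝ} (hw : 0 < D.fl w) (heq : D.fl w = D.fh w)
    {v : ℝ} (hv : v ≤ w) : D.fh v ≤ D.fl v := by
  rcases (D.fl_nonneg v).eq_or_lt' with h | h
  · rw [h, D.fh_eq_zero_of_fl_eq_zero h]
  · have := D.lr_strictMono.monotoneOn ((D.fl_pos_iff v).1 h) ((D.fl_pos_iff w).1 hw) hv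
    simpa only [← heq, div_self hw.ne', div_le_one h] using this

lemma fl_le_fh_of_le {w : ℝ} (hw : 0 < D.fl w) (heq : D.fl w = D.fh w)
    {v : ℝ} (hv : w ≤ v) : D.fl v ≤ D.fh v := by
  rcases (D.fl_nonneg v).eq_or_lt' with h | h
  · rw [h, D.fh_eq_zero_of_fl_eq_zero h]
  · have := D.lr_strictMono.monotoneOn ((D.fl_pos_iff w).1 hw) ((D.fl_pos_iff v).1 h) hv
    simpa only [← heq, div_self hw.ne', one_le_div h] using this

lemma monotoneOn_Δ {w : ℝ} (hw : 0 < D.fl w) (heq : D.fl w = D.fh w) :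
    MonotoneOn D.Δ (Iic w) := by
  intro x _ y hy hxy
  have h : D.μh (Ioc x y) ≤ D.μl (Ioc x y) := by
    rw [D.μl_apply measurableSet_Ioc, D.μh_apply measurableSet_Ioc]
    exact setLIntegral_mono' measurableSet_Ioc fun v hv =>
      ENNReal.ofReal_le_ofReal (D.fh_le_fl_of_le hw heq (hv.2.trans hy))
  rw [D.μl_Ioc, D.μh_Ioc,
    ENNReal.ofReal_le_ofReal_iff (sub_nonneg.2 (D.monotone_Fl hxy))] at h
  simp only [Δ]
  linarith

lemma setLIntegral_ratio {s : Set ℝ} (hs : MeasurableSet s) :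
    ∫⁻ v in s, ENNReal.ofReal (D.fl v / D.fh v) ∂D.μh = D.μl s := by
  rw [D.dens_h, setLIntegral_withDensity_eq_setLIntegral_mul _ D.meas_fh.ennreal_ofReal
    D.measurable_ofReal_ratio hs, D.μl_apply hs]
  refine setLIntegral_congr_fun hs fun v _ => ?_
  rw [Pi.mul_apply, ← ENNReal.ofReal_mul (D.fh_nonneg v),
    mul_div_cancel_of_imp' D.fl_eq_zero_of_fh_eq_zero]

lemma setLIntegral_one_sub_ratio_add {w : ℝ} (hw : 0 < D.fl w) (heq : D.fl w = D.fh w)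
    {s : Set ℝ} (hs : MeasurableSet s) (hsub : s ⊆ Ici w) :
    ∫⁻ v in s, ENNReal.ofReal (1 - D.fl v / D.fh v) ∂D.μh + D.μl s = D.μh s := by
  rw [← D.setLIntegral_ratio hs, ← lintegral_add_right _ D.measurable_ofReal_ratio,
    ← setLIntegral_one]
  refine setLIntegral_congr_fun hs fun v hv => ?_
  have h1 : D.fl v / D.fh v ≤ 1 :=
    div_le_one_of_le₀ (D.fl_le_fh_of_le hw heq (hsub hv)) (D.fh_nonneg v)
  rw [← ENNReal.ofReal_add (sub_nonneg.2 h1) (div_nonneg (D.fl_nonneg v) (D.fh_nonneg v)),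
    sub_add_cancel, ENNReal.ofReal_one]

/-- Monotone rearrangement of `μh` on `(a, b]` onto the `μl`-quantiles `(Fh a + d, Fh b + d]`. -/
lemma setLIntegral_dirac_invCdf_shift {a b d : ℝ} (ha : 0 < D.Fh a + d)
    (hb : D.Fh b + d = D.Fl b) (x : ℝ) :
    ∫⁻ v in Ioc a b, Measure.dirac (invCdf D.Fl (D.Fh v + d)) (Iic x) ∂D.μh
      = ENNReal.ofReal (D.Fl (min x b) - (D.Fh a + d)) := by
  rw [lintegral_dirac_Iic (D.μh.restrict (Ioc a b)) (t := D.Fl x - (D.Fh a + d)),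
    Measure.restrict_apply_univ, D.μh_Ioc, ← ENNReal.ofReal_min,
    D.monotone_Fl.map_min, ← min_sub_sub_right]
  · congr 2
    linarith
  · refine ae_restrict_of_forall_mem measurableSet_Ioc fun v hv _ => ?_
    have h1 : D.Fh a ≤ D.Fh v := D.monotone_Fh hv.1.le
    have h2 : D.Fh v ≤ D.Fh b := D.monotone_Fh hv.2
    rw [mCdf_restrict_Ioc _ hv, Fl, invCdf_mCdf_le_iff D.μl (b := b) (by linarith)
      (by change _ ≤ D.Fl b; linarith)]
    change D.Fh v + d ≤ D.Fl x ↔ D.Fh v - D.Fh a ≤ D.Fl x - (D.Fh a + d)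
    constructor <;> intro h <;> linarith

/-- Rearrangement of `μh` on `(-∞, a]` onto the excess mass `μl - μh` on `(b, b']`. -/
lemma setLIntegral_dirac_lowerDeltaInv {w : ℝ} (hw : 0 < D.fl w) (heq : D.fl w = D.fh w)
    {a b b' : ℝ} (hbb : b ≤ b') (hbw : b' ≤ w) (hmass : D.Fh a = D.Δ b' - D.Δ b) (x : ℝ) :
    ∫⁻ v in Iic a, Measure.dirac (lowerDeltaInv D.Δ (D.Fh v + D.Δ b)) (Iic x) ∂D.μh
      = ENNReal.ofReal (D.Δ (min x b') - D.Δ b) := by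
  have hmono := D.monotoneOn_Δ hw heq
  rw [lintegral_dirac_Iic (D.μh.restrict (Iic a)) (t := D.Δ (min x b') - D.Δ b),
    Measure.restrict_apply_univ, ← ofReal_mCdf, ← ENNReal.ofReal_min, min_eq_left]
  · have h := hmono ((min_le_right x b').trans hbw) hbw (min_le_right x b')
    change _ ≤ D.Fh a
    linarith
  · refine ae_restrict_of_forall_mem measurableSet_Iic fun v hv => ?_
    rw [mCdf_restrict_Iic _ hv]
    change 0 < D.Fh v → (_ ↔ D.Fh v ≤ _)
    intro hpos
    have hne : b' ∈ {u | D.Fh v + D.Δ b ≤ D.Δ u} := by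
      have := D.monotone_Fh hv
      change D.Fh v + D.Δ b ≤ D.Δ b'
      linarith
    have hbdd : BddBelow {u | D.Fh v + D.Δ b ≤ D.Δ u} := by
      refine ⟨b, fun u hu => le_of_not_gt fun h => ?_⟩
      have h1 := hmono (h.le.trans (hbb.trans hbw)) (hbb.trans hbw) h.le
      change D.Fh v + D.Δ b ≤ D.Δ u at hu
      linarith
    have hmem := (isClosed_le continuous_const D.continuous_Δ).csInf_mem ⟨b', hne⟩ hbdd
    rw [le_sub_iff_add_le]
    constructor
    · intro h
      have hle := le_min h (csInf_le hbdd hne)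
      have hxw := (min_le_right x b').trans hbw
      exact hmem.trans (hmono (hle.trans hxw) hxw hle)
    · exact fun h => (csInf_le hbdd h).trans (min_le_left _ _)

/-- Rearrangement of the excess mass `μh - μl` on `(b, ∞)` onto the `μl`-quantiles below `Δ b`. -/
lemma setLIntegral_dirac_invCdf_excess {w : ℝ} (hw : 0 < D.fl w) (heq : D.fl w = D.fh w)
    {b : ℝ} (hwb : w ≤ b) (x : ℝ) :
    ∫⁻ v in Ioi b, ENNReal.ofReal (1 - D.fl v / D.fh v) *
        Measure.dirac (invCdf D.Fl (D.Δ b - D.Δ v)) (Iic x) ∂D.μh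
      = ENNReal.ofReal (min (D.Fl x) (D.Δ b)) := by
  set g : ℝ → ENNReal := fun v => ENNReal.ofReal (1 - D.fl v / D.fh v)
  have hgm : Measurable g := (measurable_const.sub (D.meas_fl.div D.meas_fh)).ennreal_ofReal
  set m := (D.μh.restrict (Ioi b)).withDensity g with hm
  have hsub : Ioi b ⊆ Ici w := fun v hv => hwb.trans (le_of_lt hv)
  have hexc : ∀ s, MeasurableSet s → m s + D.μl (s ∩ Ioi b) = D.μh (s ∩ Ioi b) := by
    intro s hs
    rw [hm, withDensity_apply _ hs, Measure.restrict_restrict hs]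
    exact D.setLIntegral_one_sub_ratio_add hw heq (hs.inter measurableSet_Ioi)
      (inter_subset_right.trans hsub)
  have hreal : ∀ s, MeasurableSet s →
      (m s).toReal = D.μh.real (s ∩ Ioi b) - D.μl.real (s ∩ Ioi b) := by
    intro s hs
    rw [measureReal_def, ← hexc s hs, ENNReal.toReal_add _ (measure_ne_top _ _),
      measureReal_def, add_sub_cancel_right]
    exact ne_top_of_le_ne_top (measure_ne_top D.μh _) (le_self_add.trans (hexc s hs).le)
  have hfin : IsFiniteMeasure m :=
    ⟨(le_self_add.trans (hexc univ .univ).le).trans_lt (measure_lt_top _ _)⟩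
  have hcdf : ∀ v, b < v → mCdf m v = D.Δ b - D.Δ v := by
    intro v hv
    rw [mCdf, hreal _ measurableSet_Iic, inter_comm, Ioi_inter_Iic, measureReal_def,
      measureReal_def, D.μl_Ioc, D.μh_Ioc,
      ENNReal.toReal_ofReal (sub_nonneg.2 (D.monotone_Fl hv.le)),
      ENNReal.toReal_ofReal (sub_nonneg.2 (D.monotone_Fh hv.le))]
    simp only [Δ]
    ring
  have huniv : m.real univ = D.Δ b := by
    rw [measureReal_def, hreal _ .univ, univ_inter, ← compl_Iic,
      probReal_compl_eq_one_sub measurableSet_Iic, probReal_compl_eq_one_sub measurableSet_Iic]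
    simp only [Δ, Fl, Fh, mCdf, measureReal_def]
    ring
  have htop : ∀ᵐ v ∂(D.μh.restrict (Ioi b)), g v < ⊤ := ae_of_all _ fun _ => ENNReal.ofReal_lt_top
  have hint := lintegral_withDensity_eq_lintegral_mul_non_measurable _ hgm htop
    fun v => Measure.dirac (invCdf D.Fl (D.Δ b - D.Δ v)) (Iic x)
  simp only [Pi.mul_apply] at hint
  rw [← hint, lintegral_dirac_Iic m (t := D.Fl x), ENNReal.ofReal_min, ← huniv, ofReal_measureReal]
  have hmem : ∀ᵐ v ∂m, v ∈ Ioi b :=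
    withDensity_absolutelyContinuous _ _ (ae_restrict_mem measurableSet_Ioi)
  filter_upwards [hmem] with v hv hpos
  rw [hcdf v hv] at hpos ⊢
  refine invCdf_mCdf_le_iff D.μl (b := b) hpos ?_
  have h1 : mCdf m v ≤ m.real univ := measureReal_mono (subset_univ _)
  rw [hcdf v hv, huniv] at h1
  exact h1.trans (D.Δ_le_Fl b)

end MarketData

lemma gammaStar_univ (D : MarketData) (κ : Kappa) {w : ℝ} (hw : 0 < D.fl w)
    (heq : D.fl w = D.fh w) (hw5 : w < κ.k5) (v : ℝ) : gammaStar D κ v univ = 1 := by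
  unfold gammaStar
  split_ifs with h1 h2 h3 h4
  · exact measure_univ
  · exact measure_univ
  · exact measure_univ
  · exact measure_univ
  · have hr : D.fl v / D.fh v ≤ 1 :=
      div_le_one_of_le₀ (D.fl_le_fh_of_le hw heq (hw5.trans (not_le.1 h4)).le) (D.fh_nonneg v)
    simp only [Measure.add_apply, Measure.smul_apply, measure_univ, smul_eq_mul, mul_one]
    rw [← ENNReal.ofReal_add (div_nonneg (D.fl_nonneg v) (D.fh_nonneg v)) (sub_nonneg.2 hr),
      add_sub_cancel, ENNReal.ofReal_one]

lemma setLIntegral_Iic_eq_add (μ : Measure ℝ) (f : ℝ → ENNReal) {a b : ℝ} (hab : a ≤ b) :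
    ∫⁻ v in Iic b, f v ∂μ = ∫⁻ v in Iic a, f v ∂μ + ∫⁻ v in Ioc a b, f v ∂μ := by
  rw [← Iic_union_Ioc_eq_Iic hab,
    lintegral_union measurableSet_Ioc (Iic_disjoint_Ioc le_rfl)]

/-- The `ρ⋆`-mass of `{v_l ≤ x}`, computed region by region. -/
lemma lintegral_gammaStar_Iic (D : MarketData) (κ : Kappa) {w : ℝ} (hw : 0 < D.fl w)
    (heq : D.fl w = D.fh w) (h13 : κ.k1 ≤ κ.k3) (h34 : κ.k3 ≤ κ.k4) (h45 : κ.k4 ≤ κ.k5)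
    (h4w : κ.k4 ≤ w) (hw5 : w ≤ κ.k5) (hpos : 0 < D.Δ κ.k4)
    (e1 : D.Δ κ.k3 + D.Fh κ.k1 = D.Δ κ.k4) (e2 : D.Δ κ.k5 = D.Δ κ.k4) (x : ℝ) :
    ∫⁻ v, gammaStar D κ v (Iic x) ∂D.μh =
      ENNReal.ofReal (D.Δ (min x κ.k4) - D.Δ κ.k3) +
      ENNReal.ofReal (D.Fl (min x κ.k3) - D.Δ κ.k4) +
      ENNReal.ofReal (D.Fh (min x κ.k4) - D.Fh κ.k3) +
      ENNReal.ofReal (D.Fl (min x κ.k5) - D.Fl κ.k4) +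
      (ENNReal.ofReal (D.Fl x - D.Fl κ.k5) + ENNReal.ofReal (min (D.Fl x) (D.Δ κ.k4))) := by
  rw [← lintegral_add_compl _ (measurableSet_Iic (a := κ.k5)), compl_Iic,
    setLIntegral_Iic_eq_add _ _ h45, setLIntegral_Iic_eq_add _ _ h34,
    setLIntegral_Iic_eq_add _ _ h13]
  congr 1
  · congr 1
    · congr 1
      · congr 1
        · rw [← D.setLIntegral_dirac_lowerDeltaInv hw heq h34 h4w (a := κ.k1) (by linarith)]
          refine setLIntegral_congr_fun measurableSet_Iic fun v hv => ?_
          simp only [gammaStar, if_pos (mem_Iic.1 hv)]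
        · rw [← e1, add_comm (D.Δ κ.k3), ← D.setLIntegral_dirac_invCdf_shift (by linarith)
            (by linarith [D.Δ_add_Fh κ.k3])]
          refine setLIntegral_congr_fun measurableSet_Ioc fun v hv => ?_
          simp only [gammaStar, if_neg hv.1.not_ge, if_pos hv.2]
      · rw [← D.μh_Ioc, min_comm, ← Ioc_inter_Iic, inter_comm, ← setLIntegral_dirac_self_Iic]
        refine setLIntegral_congr_fun measurableSet_Ioc fun v hv => ?_
        simp only [gammaStar, if_neg (h13.trans_lt hv.1).not_ge, if_neg hv.1.not_ge, if_pos hv.2]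
    · have e4 : D.Fl κ.k4 = D.Fh κ.k4 + D.Δ κ.k4 := by linarith [D.Δ_add_Fh κ.k4]
      rw [e4, ← D.setLIntegral_dirac_invCdf_shift
        (by linarith [mCdf_nonneg D.μh κ.k4, show D.Fh κ.k4 = mCdf D.μh κ.k4 from rfl])
        (by linarith [D.Δ_add_Fh κ.k5])]
      refine setLIntegral_congr_fun measurableSet_Ioc fun v hv => ?_
      simp only [gammaStar, if_neg ((h13.trans h34).trans_lt hv.1).not_ge,
        if_neg (h34.trans_lt hv.1).not_ge, if_neg hv.1.not_ge, if_pos hv.2]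
  · rw [← e2, ← D.setLIntegral_dirac_invCdf_excess hw heq hw5, ← D.μl_Ioc,
      ← Ioi_inter_Iic, inter_comm, ← D.setLIntegral_ratio (measurableSet_Iic.inter measurableSet_Ioi),
      ← Measure.restrict_restrict measurableSet_Iic, ← lintegral_indicator measurableSet_Iic,
      ← lintegral_add_left (D.measurable_ofReal_ratio.indicator measurableSet_Iic)]
    refine setLIntegral_congr_fun measurableSet_Ioi fun v hv => ?_
    have hv' : κ.k5 < v := hv
    simp only [gammaStar, if_neg (((h13.trans h34).trans h45).trans_lt hv').not_ge,
      if_neg ((h34.trans h45).trans_lt hv').not_ge, if_neg (h45.trans_lt hv').not_ge,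
      if_neg hv'.not_ge, Measure.add_apply, Measure.smul_apply, smul_eq_mul]
    rw [Measure.dirac_apply' v measurableSet_Iic]
    congr 1
    by_cases hx : v ∈ Iic x <;> simp [hx]

lemma lintegral_gammaStar_Iic_eq_μl (D : MarketData) (κ : Kappa) {w : ℝ} (hw : 0 < D.fl w)
    (heq : D.fl w = D.fh w) (h12 : κ.k1 ≤ κ.k2) (h23 : κ.k2 ≤ κ.k3) (h34 : κ.k3 ≤ κ.k4)
    (h45 : κ.k4 ≤ κ.k5) (h4w : κ.k4 ≤ w) (hw5 : w ≤ κ.k5) (hpos : 0 < D.Δ κ.k4)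
    (e1 : D.Δ κ.k3 + D.Fh κ.k1 = D.Δ κ.k4) (e2 : D.Δ κ.k5 = D.Δ κ.k4)
    (e3 : D.Fl κ.k2 = D.Δ κ.k4) (x : ℝ) :
    ∫⁻ v, gammaStar D κ v (Iic x) ∂D.μh = D.μl (Iic x) := by
  rw [lintegral_gammaStar_Iic D κ hw heq (h12.trans h23) h34 h45 h4w hw5 hpos e1 e2,
    ← ofReal_mCdf, ← e3, ← D.monotone_Fl.map_min]
  change _ = ENNReal.ofReal (D.Fl x)
  have hΔ {u v : ℝ} (huv : u ≤ v) (hv : v ≤ κ.k4) : D.Δ u ≤ D.Δ v :=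
    D.monotoneOn_Δ hw heq (huv.trans (hv.trans h4w)) (hv.trans h4w) huv
  have hl {u v : ℝ} (h : u ≤ v) : D.Fl u ≤ D.Fl v := D.monotone_Fl h
  have hh {u v : ℝ} (h : u ≤ v) : D.Fh u ≤ D.Fh v := D.monotone_Fh h
  have h0 (v : ℝ) : 0 ≤ D.Fl v := mCdf_nonneg D.μl v
  have s3 := D.Δ_add_Fh κ.k3
  have s4 := D.Δ_add_Fh κ.k4
  have sx := D.Δ_add_Fh x
  have zero {a b : ℝ} (h : a ≤ b) : ENNReal.ofReal (a - b) = 0 :=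
    ENNReal.ofReal_of_nonpos (sub_nonpos.2 h)
  have h24 := h23.trans h34
  have h25 := h24.trans h45
  have h35 := h34.trans h45
  have t1 := hl h23
  have t2 := hl h34
  have t3 := hl h45
  have t4 := hh h34
  have t5 := hΔ h34 le_rfl
  have t6 := h0 κ.k2
  rcases le_total x κ.k2 with hx | hx
  · have g3 := hx.trans h23
    have g4 := hx.trans h24
    have g5 := hx.trans h25
    rw [min_eq_left hx, min_eq_left g3, min_eq_left g4, min_eq_left g5, zero (hΔ g3 h34),
      zero (hl hx), zero (hh g3), zero (hl g4), zero (hl g5)]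
    simp
  have t7 := hl hx
  rcases le_total x κ.k3 with hx3 | hx3
  · have g4 := hx3.trans h34
    have g5 := hx3.trans h35
    rw [min_eq_right hx, min_eq_left hx3, min_eq_left g4, min_eq_left g5, zero (hΔ hx3 h34),
      zero (hh hx3), zero (hl g4), zero (hl g5), zero_add, zero_add, add_zero, add_zero,
      ← ENNReal.ofReal_add (sub_nonneg.2 t7) t6, sub_add_cancel]
  have t8 := hh hx3
  rcases le_total x κ.k4 with hx4 | hx4
  · have g5 := hx4.trans h45
    have t9 := hΔ hx3 hx4
    rw [min_eq_right hx, min_eq_right hx3, min_eq_left hx4, min_eq_left g5, zero (hl hx4),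
      zero (hl g5), zero_add, add_zero, ← ENNReal.ofReal_add (by linarith) (by linarith),
      ← ENNReal.ofReal_add (by linarith) (by linarith),
      ← ENNReal.ofReal_add (by linarith) (by linarith)]
    congr 1
    linarith
  have t9 := hl hx4
  rcases le_total x κ.k5 with hx5 | hx5
  · rw [min_eq_right hx, min_eq_right hx3, min_eq_right hx4, min_eq_left hx5, zero (hl hx5),
      zero_add, ← ENNReal.ofReal_add (by linarith) (by linarith),
      ← ENNReal.ofReal_add (by linarith) (by linarith),
      ← ENNReal.ofReal_add (by linarith) (by linarith),
      ← ENNReal.ofReal_add (by linarith) (by linarith)]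
    congr 1
    linarith
  · have t10 := hl hx5
    rw [min_eq_right hx, min_eq_right hx3, min_eq_right hx4, min_eq_right hx5,
      ← ENNReal.ofReal_add (by linarith) (by linarith),
      ← ENNReal.ofReal_add (by linarith) (by linarith),
      ← ENNReal.ofReal_add (by linarith) (by linarith),
      ← ENNReal.ofReal_add (by linarith) (by linarith),
      ← ENNReal.ofReal_add (by linarith) (by linarith)]
    congr 1
    linarith

/-- the measure `ρ⋆` defined by `ρ⋆(A × B) = ∫_B γ⋆(v_h)(A) dμ_h(v_h)`
is a coupling of `(F_l, F_h)`: its marginals are `μ_l` and `μ_h`. -/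
theorem stmt2 (D : MarketData) (c α : ℝ) (hc : 0 ≤ c) (hα : α ∈ Ioo (0 : ℝ) 1)
    (vstar : ℝ) (hv : IsVStar D vstar)
    (hns : D.Fl c < tvDist D.μl D.μh)
    (κ : Kappa) (hκ : KappaSystem D.Fl D.Fh c α κ ∧ κ.k4 < vstar ∧ vstar < κ.k5)
    (ρstar : Measure (ℝ × ℝ)) (hρprob : IsProbabilityMeasure ρstar)
    (hρdef : ∀ A B : Set ℝ, MeasurableSet A → MeasurableSet B →
      ρstar (A ×ˢ B) = ∫⁻ vh in B, gammaStar D κ vh A ∂D.μh) :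
    ρstar.fst = D.μl ∧ ρstar.snd = D.μh := by
  obtain ⟨⟨h12, h23, h34, h45, q3, q4, q5, -, hk⟩, h4w, hw5⟩ := hκ
  have h2pos : 0 < κ.k2 := by
    have : 0 < α * (κ.k5 - κ.k4) := mul_pos hα.1 (sub_pos.2 (h4w.trans hw5))
    linarith
  have pos_of_eq {q : ℝ} (h : κ.k2 = invCdf D.Fl q) : 0 < q := by
    by_contra! hq
    exact h2pos.ne' (h.trans (invCdf_mCdf_of_nonpos D.μl hq))
  have Fl_eq {q b : ℝ} (h : κ.k2 = invCdf D.Fl q) (hb : q ≤ D.Fl b) : D.Fl κ.k2 = q := by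
    rw [h]
    exact mCdf_invCdf D.μl (pos_of_eq h) hb
  have e3 : D.Fl κ.k2 = D.Δ κ.k3 + D.Fh κ.k1 := by
    refine Fl_eq q3 (b := κ.k3) ?_
    linarith [D.monotone_Fh (h12.trans h23), D.Δ_add_Fh κ.k3]
  have e4 : D.Fl κ.k2 = D.Δ κ.k4 := Fl_eq q4 (D.Δ_le_Fl _)
  have e5 : D.Fl κ.k2 = D.Δ κ.k5 := Fl_eq q5 (D.Δ_le_Fl _)
  have hpos : 0 < D.Δ κ.k4 := pos_of_eq q4
  have hw : 0 < D.fl vstar := D.fl_pos_of_Δ_pos hpos (pos_of_eq q5) h4w hw5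
  constructor
  · refine Measure.ext_of_Iic _ _ fun x => ?_
    rw [Measure.fst_apply measurableSet_Iic, ← prod_univ, hρdef _ _ measurableSet_Iic .univ,
      setLIntegral_univ]
    exact lintegral_gammaStar_Iic_eq_μl D κ hw hv.1 h12 h23 h34 h45 h4w.le hw5.le hpos
      (e3.symm.trans e4) (e5.symm.trans e4) e4 x
  · ext B hB
    rw [Measure.snd_apply hB, ← univ_prod, hρdef _ _ .univ hB]
    simp only [gammaStar_univ D κ hw hv.1 hw5, setLIntegral_one]
end
end

section
/- Assume ∫ v dμ_h(v) < ∞. For every non-discriminatory pricing rule (p_l, p_h) taking values in [0, ∞), the profit satisfies Π(p) ≤ sup over all couplings ρ of (F_l, F_h) of ∫ π dρ. -/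
open MeasureTheory Set Filter

noncomputable section

/-- The uniform (Lebesgue) probability measure on `[0,1]`. -/
def unif : Measure ℝ := volume.restrict (Icc (0 : ℝ) 1)

/-- A pricing rule `(p_l, p_h)` is non-discriminatory if the price distribution
faced by `l`-consumers equals the price distribution faced by `h`-consumers. -/
def NonDiscriminatory (μl μh : Measure ℝ) (pl ph : ℝ × ℝ → ℝ) : Prop :=
  (μl.prod unif).map pl = (μh.prod unif).map ph

/-- The seller's profit from the pricing rule `(p_l, p_h)`. -/
def profit (μl μh : Measure ℝ) (c α : ℝ) (pl ph : ℝ × ℝ → ℝ) : ℝ :=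
  (1 - α) * ∫ x, (if pl x ≤ x.1 then pl x - c else 0) ∂(μl.prod unif) +
    α * ∫ x, (if ph x ≤ x.1 then ph x - c else 0) ∂(μh.prod unif)

open ProbabilityTheory in
/-- Two probability measures on `ℝ × ℝ` with the same first marginal can be glued along it. -/
theorem exists_gluing (m n : Measure (ℝ × ℝ)) [IsProbabilityMeasure m] [IsProbabilityMeasure n]
    (h : m.fst = n.fst) :
    ∃ T : Measure (ℝ × ℝ × ℝ),
      T.map (fun t => (t.1, t.2.1)) = m ∧ T.map (fun t => (t.1, t.2.2)) = n := by
  refine ⟨m.fst ⊗ₘ (m.condKernel ×ₖ n.condKernel), ?_, ?_⟩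
  · have := Measure.compProd_map (μ := m.fst) (κ := m.condKernel ×ₖ n.condKernel)
      (measurable_fst (α := ℝ) (β := ℝ))
    rw [← Kernel.fst_eq, Kernel.fst_prod, m.disintegrate] at this
    exact this.symm
  · have := Measure.compProd_map (μ := m.fst) (κ := m.condKernel ×ₖ n.condKernel)
      (measurable_snd (α := ℝ) (β := ℝ))
    rw [← Kernel.snd_eq, Kernel.snd_prod, h, n.disintegrate] at this
    rw [h]
    exact this.symm

instance : IsProbabilityMeasure unif := ⟨by simp [unif]⟩

/-- The likelihood ratio reaches `1`, and from there on `fl` is dominated by `fh`. -/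
theorem MarketData.exists_fl_le_fh (D : MarketData) : ∃ v₀ : ℝ, ∀ v, v₀ ≤ v → D.fl v ≤ D.fh v := by
  have := D.probl
  have := D.probh
  obtain ⟨v₀, h₁, h₂, h₃⟩ :
      ∃ v₀ : ℝ, D.vlo < v₀ ∧ (v₀ : EReal) < D.vhi ∧ D.fl v₀ ≤ D.fh v₀ := by
    by_contra! hlt
    have hle : ∀ v, D.fh v ≤ D.fl v := fun v => by
      by_cases hv : 0 < D.fh v
      · obtain ⟨h₁, h₂⟩ := (D.fh_pos_iff v).1 hv
        exact (hlt v h₁ h₂).le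
      · exact (not_lt.1 hv).trans (D.fl_nonneg v)
    have hl : ∫⁻ v, ENNReal.ofReal (D.fl v) = 1 := by
      have := measure_univ (μ := D.μl)
      rwa [D.dens_l, withDensity_apply _ MeasurableSet.univ, Measure.restrict_univ] at this
    have hh : ∫⁻ v, ENNReal.ofReal (D.fh v) = 1 := by
      have := measure_univ (μ := D.μh)
      rwa [D.dens_h, withDensity_apply _ MeasurableSet.univ, Measure.restrict_univ] at this
    have hae := ae_eq_of_ae_le_of_lintegral_le
      (ae_of_all volume fun v => ENNReal.ofReal_le_ofReal (hle v)) (by simp [hh])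
      D.meas_fl.ennreal_ofReal.aemeasurable (by rw [hl, hh])
    have hzero : D.μl (univ : Set ℝ) = 0 := by
      rw [D.dens_l, withDensity_apply _ MeasurableSet.univ, Measure.restrict_univ,
        lintegral_eq_zero_iff D.meas_fl.ennreal_ofReal]
      filter_upwards [hae] with v hv
      rw [ENNReal.ofReal_eq_ofReal_iff (D.fh_nonneg v) (D.fl_nonneg v)] at hv
      by_contra hne
      have hpos : 0 < D.fl v := by simpa using hne
      obtain ⟨h₁, h₂⟩ := (D.fl_pos_iff v).1 hpos
      exact (hlt v h₁ h₂).ne hv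
    simp at hzero
  refine ⟨v₀, fun v hv => ?_⟩
  by_cases hfl : 0 < D.fl v
  · obtain ⟨h₄, h₅⟩ := (D.fl_pos_iff v).1 hfl
    have hr := D.lr_strictMono.monotoneOn ⟨h₁, h₂⟩ ⟨h₄, h₅⟩ hv
    have h₀ : 1 ≤ D.fh v₀ / D.fl v₀ := (one_le_div ((D.fl_pos_iff v₀).2 ⟨h₁, h₂⟩)).2 h₃
    exact (one_le_div hfl).1 (h₀.trans hr)
  · exact (not_lt.1 hfl).trans (D.fh_nonneg v)

theorem MarketData.ae_nonneg_l (D : MarketData) : ∀ᵐ v ∂D.μl, 0 ≤ v := by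
  rw [D.dens_l, ae_withDensity_iff D.meas_fl.ennreal_ofReal]
  refine ae_of_all _ fun v hv => ?_
  have hpos : 0 < D.fl v := by simpa using hv
  exact D.vlo_nonneg.trans ((D.fl_pos_iff v).1 hpos).1.le

/-- A finite `h`-mean forces a finite `l`-mean. -/
theorem MarketData.integrable_l (D : MarketData) (hmom : Integrable (fun v : ℝ => v) D.μh) :
    Integrable (fun v : ℝ => v) D.μl := by
  have := D.probl
  obtain ⟨v₀, hv₀⟩ := D.exists_fl_le_fh
  rw [← integrableOn_univ, ← Iic_union_Ici (a := v₀)]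
  refine IntegrableOn.union ?_ ?_
  · refine Integrable.of_bound (C := v₀) measurable_id.aestronglyMeasurable ?_
    filter_upwards [ae_restrict_of_ae D.ae_nonneg_l, ae_restrict_mem measurableSet_Iic]
      with v h₀ h₁
    rw [Real.norm_of_nonneg h₀]
    exact h₁
  · refine hmom.mono_measure ?_
    calc D.μl.restrict (Ici v₀) ≤ D.μh.restrict (Ici v₀) := by
          rw [D.dens_l, D.dens_h, restrict_withDensity measurableSet_Ici,
            restrict_withDensity measurableSet_Ici]
          refine withDensity_mono ?_
          filter_upwards [ae_restrict_mem measurableSet_Ici] with v hv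
          exact ENNReal.ofReal_le_ofReal (hv₀ v hv)
      _ ≤ D.μh := Measure.restrict_le_self

theorem measurable_pairProfit (c α : ℝ) :
    Measurable fun p : ℝ × ℝ => pairProfit c α p.1 p.2 := by
  unfold pairProfit
  fun_prop

theorem abs_pairProfit_le {c α : ℝ} (hc : 0 ≤ c) (hα : α ∈ Ioo (0 : ℝ) 1) (x y : ℝ) :
    |pairProfit c α x y| ≤ |x| + |y| + c := by
  obtain ⟨h₀, h₁⟩ := hα
  have hx := abs_nonneg x
  have hy := abs_nonneg y
  have hx' := le_abs_self x
  have hy' := le_abs_self y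
  have hnn : 0 ≤ pairProfit c α x y :=
    le_max_of_le_right (le_max_of_le_left (mul_nonneg h₀.le (le_max_right _ _)))
  rw [abs_of_nonneg hnn]
  have hmax (z : ℝ) : max (z - c) 0 ≤ |z| :=
    max_le (by linarith [le_abs_self z]) (abs_nonneg z)
  refine max_le (by linarith [min_le_left x y]) (max_le ?_ ?_)
  · have := mul_le_of_le_one_left (le_max_right (y - c) 0) h₁.le
    linarith [hmax y]
  · have := mul_le_of_le_one_left (le_max_right (x - c) 0) (by linarith : 1 - α ≤ 1)
    linarith [hmax x]

theorem le_pairProfit {c α : ℝ} (hα : α ∈ Ioo (0 : ℝ) 1) (p x y : ℝ) :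
    (1 - α) * (if p ≤ x then p - c else 0) + α * (if p ≤ y then p - c else 0) ≤
      pairProfit c α x y := by
  obtain ⟨h₀, h₁⟩ := hα
  unfold pairProfit
  split_ifs with hx hy hy
  · refine le_max_of_le_left ?_
    linarith [le_min hx hy]
  · refine le_max_of_le_right (le_max_of_le_right ?_)
    rw [mul_zero, add_zero]
    exact mul_le_mul_of_nonneg_left (le_max_of_le_left (by linarith)) (by linarith)
  · refine le_max_of_le_right (le_max_of_le_left ?_)
    rw [mul_zero, zero_add]
    exact mul_le_mul_of_nonneg_left (le_max_of_le_left (by linarith)) h₀.le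
  · refine le_max_of_le_right (le_max_of_le_left ?_)
    rw [mul_zero, mul_zero, add_zero]
    exact mul_nonneg h₀.le (le_max_right _ _)

theorem measurable_sale (c : ℝ) :
    Measurable fun q : ℝ × ℝ => if q.1 ≤ q.2 then q.1 - c else 0 :=
  Measurable.ite (measurableSet_le measurable_fst measurable_snd) (by fun_prop) (by fun_prop)

theorem integrable_sale {μ : Measure ℝ} [IsProbabilityMeasure μ] {c : ℝ} (hc : 0 ≤ c)
    (hμ : Integrable (fun v : ℝ => v) μ) {p : ℝ × ℝ → ℝ} (hp : Measurable p)
    (hp₀ : ∀ x, 0 ≤ p x) :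
    Integrable (fun x => if p x ≤ x.1 then p x - c else 0) (μ.prod unif) := by
  have hdom : Integrable (fun x : ℝ × ℝ => |x.1| + c) (μ.prod unif) :=
    (hμ.comp_fst unif).abs.add (integrable_const c)
  refine hdom.mono' ((measurable_sale c).comp (hp.prodMk measurable_fst)).aestronglyMeasurable
    (ae_of_all _ fun x => ?_)
  have := hp₀ x
  have := le_abs_self x.1
  have := abs_nonneg x.1
  split_ifs with h
  · exact abs_le.2 ⟨by linarith, by linarith⟩
  · simpa using add_nonneg (abs_nonneg x.1) hc

section Coupling

variable {μ ν : Measure ℝ} {ρ : Measure (ℝ × ℝ)}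

theorem IsCoupling.isProbabilityMeasure [IsProbabilityMeasure μ] (h : IsCoupling μ ν ρ) :
    IsProbabilityMeasure ρ :=
  ⟨by rw [← Measure.fst_univ, h.1, measure_univ]⟩

theorem IsCoupling.integrable_fst (h : IsCoupling μ ν ρ) (hμ : Integrable (fun v : ℝ => v) μ) :
    Integrable (fun p : ℝ × ℝ => p.1) ρ := by
  rw [← h.1] at hμ
  exact hμ.comp_measurable measurable_fst

theorem IsCoupling.integrable_snd (h : IsCoupling μ ν ρ) (hν : Integrable (fun v : ℝ => v) ν) :
    Integrable (fun p : ℝ × ℝ => p.2) ρ := by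
  rw [← h.2] at hν
  exact hν.comp_measurable measurable_snd

theorem IsCoupling.integrable_bound [IsProbabilityMeasure μ] (h : IsCoupling μ ν ρ)
    (hμ : Integrable (fun v : ℝ => v) μ) (hν : Integrable (fun v : ℝ => v) ν) (c : ℝ) :
    Integrable (fun p : ℝ × ℝ => |p.1| + |p.2| + c) ρ := by
  have := h.isProbabilityMeasure
  exact ((h.integrable_fst hμ).abs.add (h.integrable_snd hν).abs).add (integrable_const c)

theorem IsCoupling.integrable_pairProfit [IsProbabilityMeasure μ] (h : IsCoupling μ ν ρ)
    (hμ : Integrable (fun v : ℝ => v) μ) (hν : Integrable (fun v : ℝ => v) ν) {c α : ℝ}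
    (hc : 0 ≤ c) (hα : α ∈ Ioo (0 : ℝ) 1) :
    Integrable (fun p : ℝ × ℝ => pairProfit c α p.1 p.2) ρ :=
  (h.integrable_bound hμ hν c).mono' (measurable_pairProfit c α).aestronglyMeasurable
    (ae_of_all _ fun p => abs_pairProfit_le hc hα p.1 p.2)

end Coupling

theorem bddAbove_couplingValues {μ ν : Measure ℝ} [IsProbabilityMeasure μ]
    (hμ : Integrable (fun v : ℝ => v) μ) (hν : Integrable (fun v : ℝ => v) ν) {c α : ℝ}
    (hc : 0 ≤ c) (hα : α ∈ Ioo (0 : ℝ) 1) : BddAbove (couplingValues μ ν c α) := by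
  refine ⟨∫ v, |v| ∂μ + ∫ v, |v| ∂ν + c, ?_⟩
  rintro _ ⟨ρ, h, rfl⟩
  have := h.isProbabilityMeasure
  have h₁ := (h.integrable_fst hμ).abs
  have h₂ := (h.integrable_snd hν).abs
  calc ∫ p, pairProfit c α p.1 p.2 ∂ρ ≤ ∫ p, (|p.1| + |p.2| + c) ∂ρ :=
        integral_mono (h.integrable_pairProfit hμ hν hc hα) (h.integrable_bound hμ hν c)
          fun p => (le_abs_self _).trans (abs_pairProfit_le hc hα p.1 p.2)
    _ = ∫ p, |p.1| ∂ρ + ∫ p, |p.2| ∂ρ + c := by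
        rw [integral_add (by exact h₁.add h₂) (integrable_const c), integral_add h₁ h₂]
        simp
    _ = ∫ v, |v| ∂μ + ∫ v, |v| ∂ν + c := by
        rw [← h.1, ← h.2, Measure.fst, Measure.snd,
          integral_map measurable_fst.aemeasurable continuous_abs.aestronglyMeasurable,
          integral_map measurable_snd.aemeasurable continuous_abs.aestronglyMeasurable]

/-- the profit of any non-discriminatory pricing rule is at most the
supremum of the matched-pair profit over all couplings of `(F_l, F_h)`. -/
theorem stmt6 (D : MarketData) (c α : ℝ) (hc : 0 ≤ c) (hα : α ∈ Ioo (0 : ℝ) 1)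
    (hmom : Integrable (fun v : ℝ => v) D.μh)
    (pl ph : ℝ × ℝ → ℝ) (hpl : Measurable pl) (hph : Measurable ph)
    (hpl_nonneg : ∀ x, 0 ≤ pl x) (hph_nonneg : ∀ x, 0 ≤ ph x)
    (hnd : NonDiscriminatory D.μl D.μh pl ph) :
    profit D.μl D.μh c α pl ph ≤ sSup (couplingValues D.μl D.μh c α) := by
  have := D.probl
  have := D.probh
  have hmom_l := D.integrable_l hmom
  have hql : Measurable fun x : ℝ × ℝ => (pl x, x.1) := hpl.prodMk measurable_fst
  have hqh : Measurable fun x : ℝ × ℝ => (ph x, x.1) := hph.prodMk measurable_fst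
  have := Measure.isProbabilityMeasure_map (μ := D.μl.prod unif) hql.aemeasurable
  have := Measure.isProbabilityMeasure_map (μ := D.μh.prod unif) hqh.aemeasurable
  obtain ⟨T, hTl, hTh⟩ := exists_gluing ((D.μl.prod unif).map fun x => (pl x, x.1))
    ((D.μh.prod unif).map fun x => (ph x, x.1)) (by
      rw [Measure.fst_map_prodMk measurable_fst, Measure.fst_map_prodMk measurable_fst]
      exact hnd)
  have htl : Measurable fun t : ℝ × ℝ × ℝ => (t.1, t.2.1) := by fun_prop
  have hth : Measurable fun t : ℝ × ℝ × ℝ => (t.1, t.2.2) := by fun_prop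
  have hcoup : IsCoupling D.μl D.μh T.snd := by
    constructor
    · calc T.snd.fst = (T.map fun t => (t.1, t.2.1)).snd := by
            rw [Measure.snd_map_prodMk measurable_fst, Measure.fst, Measure.snd,
              Measure.map_map measurable_fst measurable_snd]
            rfl
        _ = D.μl := by
            rw [hTl, Measure.snd_map_prodMk hpl]
            exact Measure.fst_prod
    · calc T.snd.snd = (T.map fun t => (t.1, t.2.2)).snd := by
            rw [Measure.snd_map_prodMk measurable_fst, Measure.snd, Measure.snd,
              Measure.map_map measurable_snd measurable_snd]
            rfl
        _ = D.μh := by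
            rw [hTh, Measure.snd_map_prodMk hph]
            exact Measure.fst_prod
  have hs := measurable_sale c
  have hil : Integrable (fun t : ℝ × ℝ × ℝ => if t.1 ≤ t.2.1 then t.1 - c else 0) T := by
    have := (integrable_map_measure hs.aestronglyMeasurable hql.aemeasurable).2
      (integrable_sale hc hmom_l hpl hpl_nonneg)
    rw [← hTl] at this
    exact this.comp_measurable htl
  have hih : Integrable (fun t : ℝ × ℝ × ℝ => if t.1 ≤ t.2.2 then t.1 - c else 0) T := by
    have := (integrable_map_measure hs.aestronglyMeasurable hqh.aemeasurable).2
      (integrable_sale hc hmom hph hph_nonneg)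
    rw [← hTh] at this
    exact this.comp_measurable hth
  have hel : ∫ x, (if pl x ≤ x.1 then pl x - c else 0) ∂(D.μl.prod unif) =
      ∫ t, (if t.1 ≤ t.2.1 then t.1 - c else 0) ∂T := by
    rw [← integral_map hql.aemeasurable hs.aestronglyMeasurable, ← hTl,
      integral_map htl.aemeasurable hs.aestronglyMeasurable]
  have heh : ∫ x, (if ph x ≤ x.1 then ph x - c else 0) ∂(D.μh.prod unif) =
      ∫ t, (if t.1 ≤ t.2.2 then t.1 - c else 0) ∂T := by
    rw [← integral_map hqh.aemeasurable hs.aestronglyMeasurable, ← hTh,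
      integral_map hth.aemeasurable hs.aestronglyMeasurable]
  have hpair := hcoup.integrable_pairProfit hmom_l hmom hc hα
  refine le_trans ?_ (le_csSup (bddAbove_couplingValues hmom_l hmom hc hα) ⟨T.snd, hcoup, rfl⟩)
  rw [profit, hel, heh, ← integral_const_mul, ← integral_const_mul,
    ← integral_add (hil.const_mul _) (hih.const_mul _), Measure.snd,
    integral_map measurable_snd.aemeasurable (measurable_pairProfit c α).aestronglyMeasurable]
  exact integral_mono ((hil.const_mul _).add (hih.const_mul _))
    (hpair.comp_measurable measurable_snd) fun t => le_pairProfit hα t.1 t.2.1 t.2.2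
end
end

section
/- Let (p_l, p_h) be a non-discriminatory pricing rule, and let ν be the common price distribution, i.e. the pushforward of μ_l ⊗ U under (v,r) ↦ p_l(v,r), which by non-discrimination also equals the pushforward of μ_h ⊗ U under (v,r) ↦ p_h(v,r). Suppose κ_L and κ_H are Markov kernels from ℝ to ℝ satisfying, for all Borel sets A, T ⊆ ℝ: ∫_T κ_L(t)(A) dν(t) = (μ_l ⊗ U)({(v,r) : v ∈ A and p_l(v,r) ∈ T}) and ∫_T κ_H(t)(A) dν(t) = (μ_h ⊗ U)({(v,r) : v ∈ A and p_h(v,r) ∈ T}). Then the assignment (A, B) ↦ ∫ κ_L(t)(A)·κ_H(t)(B) dν(t) extends to a Borel probability measure ρ on ℝ² that is a coupling of (F_l, F_h): its first marginal is μ_l and its second marginal is μ_h. -/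
open MeasureTheory Set Filter

noncomputable section

lemma prod_unif_fst_preimage (μ : Measure ℝ) [SFinite μ] (A : Set ℝ) :
    (μ.prod unif) {x : ℝ × ℝ | x.1 ∈ A} = μ A := by
  have h : {x : ℝ × ℝ | x.1 ∈ A} = A ×ˢ univ := by ext; simp
  have : SFinite unif := by unfold unif; infer_instance
  rw [h, Measure.prod_prod]
  simp [unif]

open ProbabilityTheory in
/-- given a non-discriminatory pricing rule with common price
distribution `ν` and disintegrating kernels `κL, κH`, the assignment
`(A, B) ↦ ∫ κL t A · κH t B dν(t)` extends to a Borel probability measure on `ℝ²`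
which is a coupling of `(F_l, F_h)`. -/
theorem stmt8 (μl μh : Measure ℝ) [IsProbabilityMeasure μl] [IsProbabilityMeasure μh]
    (pl ph : ℝ × ℝ → ℝ) (hpl : Measurable pl) (hph : Measurable ph)
    (hnd : NonDiscriminatory μl μh pl ph)
    (ν : Measure ℝ) (hν : ν = (μl.prod unif).map pl)
    (κL κH : Kernel ℝ ℝ) [IsMarkovKernel κL] [IsMarkovKernel κH]
    (hκL : ∀ A T : Set ℝ, MeasurableSet A → MeasurableSet T →
      ∫⁻ t in T, κL t A ∂ν = (μl.prod unif) {x : ℝ × ℝ | x.1 ∈ A ∧ pl x ∈ T})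
    (hκH : ∀ A T : Set ℝ, MeasurableSet A → MeasurableSet T →
      ∫⁻ t in T, κH t A ∂ν = (μh.prod unif) {x : ℝ × ℝ | x.1 ∈ A ∧ ph x ∈ T}) :
    ∃ ρ : Measure (ℝ × ℝ), IsProbabilityMeasure ρ ∧
      (∀ A B : Set ℝ, MeasurableSet A → MeasurableSet B →
        ρ (A ×ˢ B) = ∫⁻ t, κL t A * κH t B ∂ν) ∧
      IsCoupling μl μh ρ := by
  have hprod (A B : Set ℝ) (hA : MeasurableSet A) (hB : MeasurableSet B) :
      (ν.bind (κL ×ₖ κH)) (A ×ˢ B) = ∫⁻ t, κL t A * κH t B ∂ν := by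
    rw [Measure.bind_apply (hA.prod hB) (Kernel.aemeasurable _)]
    simp [Kernel.prod_apply, Measure.prod_prod]
  have hfst : (ν.bind (κL ×ₖ κH)).fst = μl := by
    ext A hA
    rw [Measure.fst_apply hA, ← Set.prod_univ, hprod A univ hA .univ]
    simpa using (hκL A univ hA .univ).trans (by simpa using prod_unif_fst_preimage μl A)
  have hsnd : (ν.bind (κL ×ₖ κH)).snd = μh := by
    ext A hA
    rw [Measure.snd_apply hA, ← Set.univ_prod, hprod univ A .univ hA]
    simpa using (hκH A univ hA .univ).trans (by simpa using prod_unif_fst_preimage μh A)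
  refine ⟨ν.bind (κL ×ₖ κH), ⟨?_⟩, hprod, hfst, hsnd⟩
  rw [← Measure.fst_univ, hfst, measure_univ]
end
end
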